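/- Generalized swirling and shear flows: let m₀ ≥ 1 and n > 2m₀, let β₀ > 0 and z₀, v ∈ ℝ, and let A be a geodesic of SL(n) with the Hilbert–Schmidt metric whose initial data satisfy: A(0)ᵀ·A(0) = β₀^{−1/(2m₀)}·I_{2m₀} ⊕ β₀^{1/(n−2m₀)}·I_{n−2m₀}; A(0)ᵀ·A'(0) − A'(0)ᵀ·A(0) = (⊕_{i=1}^{m₀} z₀·Z₂) ⊕ 0_{n−2m₀}; and A(0)ᵀ·A'(0) + A'(0)ᵀ·A(0) = (v·β₀^{−1/(2m₀)}/(2m₀))·I_{2m₀} ⊕ (−v·β₀^{1/(n−2m₀)}/(n−2m₀))·I_{n−2m₀}. Then there exists a twice differentiable function b : ℝ → ℝ such that for all t ∈ ℝ, A(t)ᵀ·A(t) = e^{−b(t)/(2m₀)}·I_{2m₀} ⊕ e^{b(t)/(n−2m₀)}·I_{n−2m₀}. Moreover: (i) if z₀ ≠ 0, then b(t) → −∞ as t → +∞ and as t → −∞; (ii) if z₀ = 0 and v ≠ 0, then b is strictly monotone and its range is all of ℝ. -/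

import Mathlib

noncomputable section
open Matrix Filter

attribute [local instance] Matrix.normedAddCommGroup Matrix.normedSpace

/-- A geodesic of `SL(n)` with the Hilbert–Schmidt metric. -/
def IsGeodesic {ι : Type*} [Fintype ι] [DecidableEq ι] (A : ℝ → Matrix ι ι ℝ) : Prop :=
  (∀ t, DifferentiableAt ℝ A t) ∧ (∀ t, DifferentiableAt ℝ (deriv A) t) ∧
  (∀ t, (A t).det = 1) ∧
  (∀ t, deriv (deriv A) t =
    (Matrix.trace (deriv A t * (A t)⁻¹ * deriv A t * (A t)⁻¹) /
      Matrix.trace ((A t)⁻¹ * ((A t)⁻¹)ᵀ)) • ((A t)⁻¹)ᵀ)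

/-- The 2×2 rotation generator `Z₂`. -/
def Z2 : Matrix (Fin 2) (Fin 2) ℝ := !![0, -1; 1, 0]

/-- The coefficient of `(b')²` in the kinetic energy of the reduced one-dimensional system. -/
def reducedMetric (D E x : ℝ) : ℝ := Real.exp (-x / D) / D + Real.exp (x / E) / E

lemma reducedMetric_pos {D E : ℝ} (hD : 0 < D) (hE : 0 < E) (x : ℝ) :
    0 < reducedMetric D E x := by
  unfold reducedMetric; positivity

lemma hasDerivAt_reducedMetric (D E x : ℝ) :
    HasDerivAt (reducedMetric D E) (Real.exp (x / E) / E ^ 2 - Real.exp (-x / D) / D ^ 2) x := by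
  have h₁ : HasDerivAt (fun x : ℝ => Real.exp (-x / D) / D) (Real.exp (-x / D) * (-1 / D) / D) x :=
    (((hasDerivAt_id x).neg.div_const D).exp).div_const D
  have h₂ : HasDerivAt (fun x : ℝ => Real.exp (x / E) / E) (Real.exp (x / E) * (1 / E) / E) x :=
    (((hasDerivAt_id x).div_const E).exp).div_const E
  refine (h₁.add h₂).congr_deriv ?_
  ring

/-- A solution of the reduced equation of motion, in position `b` and rescaled velocity
`w = b' √g`, where `g` is the reduced metric. -/
structure IsReducedMotion (D E z : ℝ) (b w : ℝ → ℝ) : Prop where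
  hasDerivAt_pos : ∀ t, HasDerivAt b (w t / √(reducedMetric D E (b t))) t
  hasDerivAt_vel : ∀ t, HasDerivAt w
    (-(z ^ 2 * Real.exp (b t / D) / (2 * √(reducedMetric D E (b t))))) t

/-- Arc length of the reduced metric. -/
def reducedArcLength (D E x : ℝ) : ℝ := ∫ y in (0 : ℝ)..x, √(reducedMetric D E y)

lemma hasDerivAt_reducedArcLength (D E x : ℝ) :
    HasDerivAt (reducedArcLength D E) (√(reducedMetric D E x)) x := by
  have hc : Continuous fun y => √(reducedMetric D E y) :=
    (continuous_iff_continuousAt.2 fun y => (hasDerivAt_reducedMetric D E y).continuousAt).sqrt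
  exact intervalIntegral.integral_hasDerivAt_right (hc.intervalIntegrable _ _)
    (hc.stronglyMeasurableAtFilter _ _) hc.continuousAt

lemma strictMono_reducedArcLength {D E : ℝ} (hD : 0 < D) (hE : 0 < E) :
    StrictMono (reducedArcLength D E) := by
  refine strictMono_of_deriv_pos fun x => ?_
  rw [(hasDerivAt_reducedArcLength D E x).deriv]
  exact Real.sqrt_pos.2 (reducedMetric_pos hD hE x)

namespace IsReducedMotion

variable {D E z : ℝ} {b w : ℝ → ℝ}

lemma hasDerivAt_arcLength (h : IsReducedMotion D E z b w) (hD : 0 < D) (hE : 0 < E) (t : ℝ) :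
    HasDerivAt (fun t => reducedArcLength D E (b t)) (w t) t := by
  have h₁ := (hasDerivAt_reducedArcLength D E (b t)).comp t (h.hasDerivAt_pos t)
  have h₂ := Real.sqrt_pos.2 (reducedMetric_pos hD hE (b t))
  rwa [mul_div_cancel₀ _ h₂.ne'] at h₁

lemma comp_neg (h : IsReducedMotion D E z b w) :
    IsReducedMotion D E z (fun t => b (-t)) (fun t => -w (-t)) where
  hasDerivAt_pos t := by
    refine ((h.hasDerivAt_pos (-t)).comp t (hasDerivAt_neg t)).congr_deriv ?_
    ring
  hasDerivAt_vel t := by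
    refine ((h.hasDerivAt_vel (-t)).comp t (hasDerivAt_neg t)).neg.congr_deriv ?_
    ring

lemma energy_eq (h : IsReducedMotion D E z b w) (hD : 0 < D) (hE : 0 < E) (t : ℝ) :
    w t ^ 2 + D * z ^ 2 * Real.exp (b t / D) = w 0 ^ 2 + D * z ^ 2 * Real.exp (b 0 / D) := by
  have hd : ∀ t, HasDerivAt (fun t => w t ^ 2 + D * z ^ 2 * Real.exp (b t / D)) 0 t := by
    intro t
    have h₁ := Real.sqrt_pos.2 (reducedMetric_pos hD hE (b t))
    refine (((h.hasDerivAt_vel t).pow 2).add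
      ((((h.hasDerivAt_pos t).div_const D).exp).const_mul (D * z ^ 2))).congr_deriv ?_
    field_simp
    ring
  exact is_const_of_deriv_eq_zero (fun t => (hd t).differentiableAt) (fun t => (hd t).deriv) t 0

lemma antitone_vel (h : IsReducedMotion D E z b w) : Antitone w := by
  refine antitone_of_deriv_nonpos (fun t => (h.hasDerivAt_vel t).differentiableAt) fun t => ?_
  rw [(h.hasDerivAt_vel t).deriv]
  have : 0 ≤ z ^ 2 * Real.exp (b t / D) / (2 * √(reducedMetric D E (b t))) := by positivity
  linarith

lemma exists_forall_pos_le (h : IsReducedMotion D E z b w) (hD : 0 < D) (hE : 0 < E)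
    (hz : z ≠ 0) : ∃ B, ∀ t, b t ≤ B := by
  refine ⟨D * Real.log ((w 0 ^ 2 + D * z ^ 2 * Real.exp (b 0 / D)) / (D * z ^ 2)), fun t => ?_⟩
  have hz2 : 0 < D * z ^ 2 := by positivity
  have h₁ : Real.exp (b t / D) ≤ (w 0 ^ 2 + D * z ^ 2 * Real.exp (b 0 / D)) / (D * z ^ 2) := by
    rw [le_div_iff₀ hz2, ← h.energy_eq hD hE t]
    nlinarith [sq_nonneg (w t)]
  rw [← div_le_iff₀' hD, Real.le_log_iff_exp_le (by positivity)]
  exact h₁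

lemma exists_vel_neg (h : IsReducedMotion D E z b w) (hD : 0 < D) (hE : 0 < E) (hz : z ≠ 0) :
    ∃ T, w T < 0 := by
  by_contra! hw
  obtain ⟨B, hB⟩ := h.exists_forall_pos_le hD hE hz
  have hmono : Monotone b := by
    refine monotone_of_deriv_nonneg (fun t => (h.hasDerivAt_pos t).differentiableAt) fun t => ?_
    rw [(h.hasDerivAt_pos t).deriv]
    exact div_nonneg (hw t) (Real.sqrt_nonneg _)
  set K := Real.exp (-b 0 / D) / D + Real.exp (B / E) / E with hK
  have hKpos : 0 < K := by positivity
  set c := z ^ 2 * Real.exp (b 0 / D) / (2 * √K) with hc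
  have hcpos : 0 < c := by have := Real.sqrt_pos.2 hKpos; positivity
  have hle : ∀ t, 0 ≤ t → w t ≤ w 0 - c * t := by
    intro t ht
    have hanti : AntitoneOn (fun t => w t + c * t) (Set.Ici 0) := by
      have hd : ∀ t, HasDerivAt (fun t => w t + c * t)
          (-(z ^ 2 * Real.exp (b t / D) / (2 * √(reducedMetric D E (b t)))) + c * 1) t :=
        fun t => (h.hasDerivAt_vel t).add ((hasDerivAt_id t).const_mul c)
      refine antitoneOn_of_deriv_nonpos (convex_Ici 0)
        (fun t _ => (hd t).continuousAt.continuousWithinAt)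
        (fun t _ => (hd t).differentiableAt.differentiableWithinAt) fun t ht => ?_
      rw [interior_Ici] at ht
      rw [(hd t).deriv]
      have hbt := hmono (le_of_lt ht)
      have hg := reducedMetric_pos hD hE (b t)
      have hgK : reducedMetric D E (b t) ≤ K := by
        unfold reducedMetric
        rw [hK]
        gcongr
        exact hB t
      have hsq := Real.sqrt_pos.2 hg
      have : c ≤ z ^ 2 * Real.exp (b t / D) / (2 * √(reducedMetric D E (b t))) := by
        rw [hc]; gcongr
      linarith
    have := hanti (Set.mem_Ici.2 le_rfl) (Set.mem_Ici.2 ht) ht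
    simp only [mul_zero, add_zero] at this
    linarith
  have h₁ := hle ((w 0 + 1) / c) (div_nonneg (by linarith [hw 0]) hcpos.le)
  rw [mul_div_cancel₀ _ hcpos.ne'] at h₁
  linarith [hw ((w 0 + 1) / c)]

lemma tendsto_atTop (h : IsReducedMotion D E z b w) (hD : 0 < D) (hE : 0 < E) (hz : z ≠ 0) :
    Tendsto b atTop atBot := by
  obtain ⟨T, hT⟩ := h.exists_vel_neg hD hE hz
  have hanti : AntitoneOn (fun t => reducedArcLength D E (b t) - w T * t) (Set.Ici T) := by
    have hd : ∀ t, HasDerivAt (fun t => reducedArcLength D E (b t) - w T * t)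
        (w t - w T * 1) t :=
      fun t => (h.hasDerivAt_arcLength hD hE t).sub ((hasDerivAt_id t).const_mul (w T))
    refine antitoneOn_of_deriv_nonpos (convex_Ici T)
      (fun t _ => (hd t).continuousAt.continuousWithinAt)
      (fun t _ => (hd t).differentiableAt.differentiableWithinAt) fun t ht => ?_
    rw [interior_Ici] at ht
    rw [(hd t).deriv]
    linarith [h.antitone_vel (le_of_lt ht)]
  have hlim : Tendsto (fun t => reducedArcLength D E (b t)) atTop atBot := by
    have h₁ : Tendsto (fun t => w T * t + (reducedArcLength D E (b T) - w T * T)) atTop atBot :=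
      tendsto_atBot_add_const_right _ _ (tendsto_id.const_mul_atTop_of_neg hT)
    refine tendsto_atBot_mono' _ ?_ h₁
    filter_upwards [eventually_ge_atTop T] with t ht
    have := hanti (Set.mem_Ici.2 le_rfl) (Set.mem_Ici.2 ht) ht
    simp only at this
    linarith
  refine tendsto_atBot.2 fun M => ?_
  filter_upwards [tendsto_atBot.1 hlim (reducedArcLength D E M)] with t ht
  exact (strictMono_reducedArcLength hD hE).le_iff_le.1 ht

lemma tendsto_atBot (h : IsReducedMotion D E z b w) (hD : 0 < D) (hE : 0 < E) (hz : z ≠ 0) :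
    Tendsto b atBot atBot := by
  have := (h.comp_neg.tendsto_atTop hD hE hz).comp tendsto_neg_atBot_atTop
  simpa [Function.comp_def] using this

lemma vel_eq_of_eq_zero (h : IsReducedMotion D E z b w) (hz : z = 0) (t : ℝ) : w t = w 0 := by
  refine is_const_of_deriv_eq_zero (fun t => (h.hasDerivAt_vel t).differentiableAt) (fun t => ?_) t 0
  rw [(h.hasDerivAt_vel t).deriv, hz]
  simp

lemma strictMono_or_strictAnti (h : IsReducedMotion D E z b w) (hD : 0 < D) (hE : 0 < E)
    (hz : z = 0) (hw : w 0 ≠ 0) : StrictMono b ∨ StrictAnti b := by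
  rcases lt_or_gt_of_ne hw with hw | hw
  · refine Or.inr (strictAnti_of_deriv_neg fun t => ?_)
    rw [(h.hasDerivAt_pos t).deriv, h.vel_eq_of_eq_zero hz]
    exact div_neg_of_neg_of_pos hw (Real.sqrt_pos.2 (reducedMetric_pos hD hE _))
  · refine Or.inl (strictMono_of_deriv_pos fun t => ?_)
    rw [(h.hasDerivAt_pos t).deriv, h.vel_eq_of_eq_zero hz]
    exact div_pos hw (Real.sqrt_pos.2 (reducedMetric_pos hD hE _))

lemma range_eq_univ (h : IsReducedMotion D E z b w) (hD : 0 < D) (hE : 0 < E)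
    (hz : z = 0) (hw : w 0 ≠ 0) : Set.range b = Set.univ := by
  refine Set.eq_univ_of_forall fun y => ?_
  have hd : ∀ t, HasDerivAt (fun t => reducedArcLength D E (b t) - w 0 * t) 0 t := by
    intro t
    refine ((h.hasDerivAt_arcLength hD hE t).sub
      ((hasDerivAt_id t).const_mul (w 0))).congr_deriv ?_
    rw [h.vel_eq_of_eq_zero hz]
    ring
  have hconst := fun t => is_const_of_deriv_eq_zero (fun t => (hd t).differentiableAt)
    (fun t => (hd t).deriv) t 0
  refine ⟨(reducedArcLength D E y - reducedArcLength D E (b 0)) / w 0,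
    (strictMono_reducedArcLength hD hE).injective ?_⟩
  have := hconst ((reducedArcLength D E y - reducedArcLength D E (b 0)) / w 0)
  rw [mul_div_cancel₀ _ hw] at this
  linarith

end IsReducedMotion

/-- The reduced second-order equation in the form `b'' g + (b')² g' / 2 = -(z² / 2) e^{b/D}`. -/
lemma isReducedMotion_of_hasDerivAt {D E z : ℝ} (hD : 0 < D) (hE : 0 < E) {b b' b'' : ℝ → ℝ}
    (h₁ : ∀ t, HasDerivAt b (b' t) t) (h₂ : ∀ t, HasDerivAt b' (b'' t) t)
    (hode : ∀ t, b'' t * reducedMetric D E (b t) +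
      b' t ^ 2 / 2 * (Real.exp (b t / E) / E ^ 2 - Real.exp (-b t / D) / D ^ 2) =
        -(z ^ 2 / 2 * Real.exp (b t / D))) :
    IsReducedMotion D E z b (fun t => b' t * √(reducedMetric D E (b t))) where
  hasDerivAt_pos t := by
    have h := Real.sqrt_pos.2 (reducedMetric_pos hD hE (b t))
    rw [mul_div_cancel_right₀ _ h.ne']
    exact h₁ t
  hasDerivAt_vel t := by
    have hg := reducedMetric_pos hD hE (b t)
    have h := Real.sqrt_pos.2 hg
    have hs := Real.sq_sqrt hg.le
    have hd := (h₂ t).mul ((((hasDerivAt_reducedMetric D E (b t)).comp t (h₁ t))).sqrt hg.ne')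
    refine hd.congr_deriv ?_
    have hode := hode t
    simp only [Function.comp_apply]
    set s := √(reducedMetric D E (b t))
    rw [← hs] at hode
    field_simp at hode ⊢
    linarith

section Commutant

/-- The blockwise rotation generator `Z₂ ⊕ ⋯ ⊕ Z₂`. -/
def blockZ2 (κ : Type*) [DecidableEq κ] : Matrix (Fin 2 × κ) (Fin 2 × κ) ℝ :=
  blockDiagonal fun _ : κ => Z2

lemma transpose_blockZ2 {κ : Type*} [DecidableEq κ] : (blockZ2 κ)ᵀ = -blockZ2 κ := by
  rw [blockZ2, blockDiagonal_transpose, ← blockDiagonal_neg]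
  congr 1
  ext k i j
  fin_cases i <;> fin_cases j <;> simp [Z2]

variable {ι κ : Type*} [Fintype ι] [DecidableEq ι] [Fintype κ] [DecidableEq κ]

lemma exists_eq_smul_one_of_commute_orthogonal (M : Matrix ι ι ℝ)
    (h : ∀ V : Matrix ι ι ℝ, Vᵀ * V = 1 → V * M = M * V) : ∃ c : ℝ, M = c • 1 := by
  have hoff : ∀ i j, i ≠ j → M i j = 0 := by
    intro i j hij
    have hV := h (diagonal fun k => if k = i then -1 else 1) (by
      rw [diagonal_transpose, diagonal_mul_diagonal, ← diagonal_one]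
      congr 1
      ext k
      split_ifs <;> simp)
    have := congrFun (congrFun hV i) j
    rw [diagonal_mul, mul_diagonal, if_pos rfl, if_neg hij.symm] at this
    linarith
  have hdiag : ∀ i j, M i i = M j j := by
    intro i j
    have hV := h ((1 : Matrix ι ι ℝ).submatrix (Equiv.swap i j) id) (by
      rw [transpose_submatrix, submatrix_mul_equiv]
      simp)
    have := congrFun (congrFun hV i) j
    have hs : ∀ x, j = Equiv.swap i j x ↔ x = i := fun x => by
      rw [eq_comm, Equiv.swap_apply_eq_iff, Equiv.swap_apply_right]
    simpa [Matrix.mul_apply, Matrix.one_apply, eq_comm (b := j), hs] using this.symm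
  rcases isEmpty_or_nonempty ι with hι | ⟨⟨i⟩⟩
  · exact ⟨0, Subsingleton.elim _ _⟩
  · refine ⟨M i i, ?_⟩
    ext j k
    by_cases hjk : j = k
    · subst hjk
      simp [hdiag j i]
    · simp [hoff j k hjk, hjk]

lemma blockZ2_mul_self : blockZ2 κ * blockZ2 κ = -1 := by
  rw [blockZ2, ← blockDiagonal_mul, ← blockDiagonal_one, ← blockDiagonal_neg]
  congr 1
  ext k i j
  fin_cases i <;> fin_cases j <;> simp [Z2]

lemma exists_eq_smul_one_of_commute_blockZ2 (M : Matrix (Fin 2 × κ) (Fin 2 × κ) ℝ)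
    (hM : Mᵀ = M)
    (h : ∀ V : Matrix (Fin 2 × κ) (Fin 2 × κ) ℝ, Vᵀ * V = 1 →
      V * blockZ2 κ = blockZ2 κ * V → V * M = M * V) : ∃ c : ℝ, M = c • 1 := by
  have hslice : ∀ i j : Fin 2, ∃ c : ℝ, (M.submatrix (Prod.mk i) (Prod.mk j)) = c • 1 := by
    intro i j
    refine exists_eq_smul_one_of_commute_orthogonal _ fun X hX => ?_
    have hV := h (kroneckerMap (· * ·) (1 : Matrix (Fin 2) (Fin 2) ℝ) X)
      (by
        rw [← kroneckerMap_transpose, transpose_one, ← mul_kronecker_mul, hX, one_mul,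
          one_kronecker_one])
      (by
        have : blockZ2 κ = kroneckerMap (· * ·) Z2 (1 : Matrix κ κ ℝ) := by
          rw [kronecker_one]; rfl
        rw [this, ← mul_kronecker_mul, ← mul_kronecker_mul]
        simp)
    ext k l
    have := congrFun (congrFun hV (i, k)) (j, l)
    simpa [Matrix.mul_apply, Fintype.sum_prod_type, Matrix.one_apply, ite_mul, mul_ite,
      Finset.sum_ite_irrel] using this
  choose c hc using hslice
  have hMc : ∀ i j k l, M (i, k) (j, l) = c i j * (1 : Matrix κ κ ℝ) k l := fun i j k l =>
    congrFun (congrFun (hc i j) k) l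
  have hV := h (blockZ2 κ) (by rw [transpose_blockZ2, neg_mul, blockZ2_mul_self, neg_neg]) rfl
  rcases isEmpty_or_nonempty κ with hκ | ⟨⟨a⟩⟩
  · exact ⟨0, Subsingleton.elim _ _⟩
  have hsymm : c 0 1 = c 1 0 := by
    have := congrFun (congrFun hM (1, a)) (0, a)
    simpa [hMc] using this
  have e₁ : -c 1 0 = c 0 1 := by
    have := congrFun (congrFun hV (0, a)) (0, a)
    simpa [Matrix.mul_apply, Fintype.sum_prod_type, hMc, blockZ2, Z2, blockDiagonal_apply,
      Matrix.one_apply] using this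
  have e₂ : c 1 1 = c 0 0 := by
    have := congrFun (congrFun hV (0, a)) (1, a)
    simpa [Matrix.mul_apply, Fintype.sum_prod_type, hMc, blockZ2, Z2, blockDiagonal_apply,
      Matrix.one_apply] using this
  have e₃ : c 0 1 = 0 := by linarith
  have e₄ : c 1 0 = 0 := by linarith
  refine ⟨c 0 0, ?_⟩
  ext ⟨i, k⟩ ⟨j, l⟩
  rw [hMc]
  fin_cases i <;> fin_cases j <;> simp [e₂, e₃, e₄, Matrix.one_apply]

lemma exists_eq_fromBlocks_smul_one (P : Matrix ((Fin 2 × κ) ⊕ ι) ((Fin 2 × κ) ⊕ ι) ℝ)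
    (hP : Pᵀ = P)
    (h : ∀ (V₁ : Matrix (Fin 2 × κ) (Fin 2 × κ) ℝ) (V₂ : Matrix ι ι ℝ),
      V₁ᵀ * V₁ = 1 → V₁ * blockZ2 κ = blockZ2 κ * V₁ → V₂ᵀ * V₂ = 1 →
        fromBlocks V₁ 0 0 V₂ * P = P * fromBlocks V₁ 0 0 V₂) :
    ∃ p q : ℝ, P = fromBlocks (p • 1) 0 0 (q • 1) := by
  obtain ⟨M, N, N', Q, rfl⟩ : ∃ M N N' Q, P = fromBlocks M N N' Q :=
    ⟨_, _, _, _, (fromBlocks_toBlocks P).symm⟩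
  simp only [fromBlocks_multiply, fromBlocks_transpose, fromBlocks_inj, Matrix.zero_mul,
    Matrix.mul_zero, add_zero, zero_add] at h hP
  obtain ⟨p, hp⟩ := exists_eq_smul_one_of_commute_blockZ2 M hP.1 fun V hV hV' =>
    (h V 1 hV hV' (by simp)).1
  obtain ⟨q, hq⟩ := exists_eq_smul_one_of_commute_orthogonal Q fun V hV =>
    (h 1 V (by simp) (by simp) hV).2.2.2
  obtain ⟨-, h₁, -⟩ := h 1 (-1) (by simp) (by simp) (by simp)
  have hN : N = 0 := by
    ext i j
    have := congrFun (congrFun h₁ i) j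
    simp only [Matrix.one_mul, Matrix.mul_neg, Matrix.mul_one, Matrix.neg_apply] at this
    rw [Matrix.zero_apply]
    linarith
  have hN' : N' = 0 := by rw [← hP.2.2.1, hN, transpose_zero]
  exact ⟨p, q, by rw [hp, hq, hN, hN']⟩

end Commutant

section Geodesic

variable {ι : Type*} [Fintype ι]

lemma hasDerivAt_matrix_iff {m n : Type*} [Fintype m] [Fintype n] {A : ℝ → Matrix m n ℝ}
    {A' : Matrix m n ℝ} {t : ℝ} :
    HasDerivAt A A' t ↔ ∀ i j, HasDerivAt (fun t => A t i j) (A' i j) t :=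
  hasDerivAt_pi.trans (forall_congr' fun _ => hasDerivAt_pi)

lemma HasDerivAt.matrix_transpose' {A : ℝ → Matrix ι ι ℝ} {A' : Matrix ι ι ℝ} {t : ℝ}
    (hA : HasDerivAt A A' t) : HasDerivAt (fun t => (A t)ᵀ) A'ᵀ t :=
  hasDerivAt_matrix_iff.2 fun i j => hasDerivAt_matrix_iff.1 hA j i

lemma HasDerivAt.matrix_mul' {A B : ℝ → Matrix ι ι ℝ} {A' B' : Matrix ι ι ℝ} {t : ℝ}
    (hA : HasDerivAt A A' t) (hB : HasDerivAt B B' t) :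
    HasDerivAt (fun t => A t * B t) (A' * B t + A t * B') t := by
  refine hasDerivAt_matrix_iff.2 fun i j => ?_
  simp only [Matrix.mul_apply, Matrix.add_apply, ← Finset.sum_add_distrib]
  exact HasDerivAt.fun_sum fun k _ =>
    (hasDerivAt_matrix_iff.1 hA i k).mul (hasDerivAt_matrix_iff.1 hB k j)

lemma contDiff_matrix_iff {E m n : Type*} [NormedAddCommGroup E] [NormedSpace ℝ E]
    [Fintype m] [Fintype n] {k : WithTop ℕ∞} {f : E → Matrix m n ℝ} :
    ContDiff ℝ k f ↔ ∀ i j, ContDiff ℝ k fun x => f x i j :=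
  contDiff_pi.trans (forall_congr' fun _ => contDiff_pi)

lemma ContDiff.matrix_mul' {E : Type*} [NormedAddCommGroup E] [NormedSpace ℝ E]
    {k : WithTop ℕ∞} {f g : E → Matrix ι ι ℝ} (hf : ContDiff ℝ k f) (hg : ContDiff ℝ k g) :
    ContDiff ℝ k fun x => f x * g x := by
  refine contDiff_matrix_iff.2 fun i j => ?_
  simp only [Matrix.mul_apply]
  exact ContDiff.sum fun l _ => (contDiff_matrix_iff.1 hf i l).mul (contDiff_matrix_iff.1 hg l j)

lemma ContDiff.matrix_trace' {E : Type*} [NormedAddCommGroup E] [NormedSpace ℝ E]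
    {k : WithTop ℕ∞} {f : E → Matrix ι ι ℝ} (hf : ContDiff ℝ k f) :
    ContDiff ℝ k fun x => (f x).trace := by
  simp only [Matrix.trace, Matrix.diag]
  exact ContDiff.sum fun i _ => contDiff_matrix_iff.1 hf i i

lemma ContDiff.matrix_transpose' {E : Type*} [NormedAddCommGroup E] [NormedSpace ℝ E]
    {k : WithTop ℕ∞} {f : E → Matrix ι ι ℝ} (hf : ContDiff ℝ k f) :
    ContDiff ℝ k fun x => (f x)ᵀ :=
  contDiff_matrix_iff.2 fun i j => contDiff_matrix_iff.1 hf j i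

variable [DecidableEq ι]

lemma HasDerivAt.matrix_const_mul_mul {A : ℝ → Matrix ι ι ℝ} {A' : Matrix ι ι ℝ} {t : ℝ}
    (hA : HasDerivAt A A' t) (U V : Matrix ι ι ℝ) :
    HasDerivAt (fun t => U * A t * V) (U * A' * V) t := by
  simpa using ((hasDerivAt_const t U).matrix_mul' hA).matrix_mul' (hasDerivAt_const t V)

/-- The Lagrange multiplier in the geodesic equation. -/
def geodesicMultiplier (X Y : Matrix ι ι ℝ) : ℝ :=
  Matrix.trace (Y * X⁻¹ * Y * X⁻¹) / Matrix.trace (X⁻¹ * (X⁻¹)ᵀ)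

/-- The geodesic vector field on pairs (position, velocity); the inverse is replaced by the
adjugate, which agrees with it on `SL(n)` and is polynomial. -/
def geodesicField (x : Matrix ι ι ℝ × Matrix ι ι ℝ) : Matrix ι ι ℝ × Matrix ι ι ℝ :=
  (x.2, (Matrix.trace (x.2 * x.1.adjugate * x.2 * x.1.adjugate) /
    Matrix.trace (x.1.adjugate * (x.1.adjugate)ᵀ)) • (x.1.adjugate)ᵀ)

lemma ContDiff.matrix_det' {E : Type*} [NormedAddCommGroup E] [NormedSpace ℝ E]
    {k : WithTop ℕ∞} {f : E → Matrix ι ι ℝ} (hf : ContDiff ℝ k f) :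
    ContDiff ℝ k fun x => (f x).det := by
  simp only [Matrix.det_apply']
  exact ContDiff.sum fun σ _ => contDiff_const.mul
    (contDiff_prod fun i _ => contDiff_matrix_iff.1 hf _ _)

lemma ContDiff.matrix_adjugate' {E : Type*} [NormedAddCommGroup E] [NormedSpace ℝ E]
    {k : WithTop ℕ∞} {f : E → Matrix ι ι ℝ} (hf : ContDiff ℝ k f) :
    ContDiff ℝ k fun x => (f x).adjugate := by
  refine contDiff_matrix_iff.2 fun i j => ?_
  simp only [Matrix.adjugate_apply]
  refine ContDiff.matrix_det' (contDiff_matrix_iff.2 fun a b => ?_)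
  by_cases h : a = j
  · subst h
    simp only [Matrix.updateRow_self]
    exact contDiff_const
  · simp only [Matrix.updateRow_ne h]
    exact contDiff_matrix_iff.1 hf a b

lemma trace_mul_transpose_self_pos [Nonempty ι] {X : Matrix ι ι ℝ} (hX : IsUnit X) :
    0 < Matrix.trace (X * Xᵀ) := by
  have h : Matrix.trace (X * Xᵀ) = ∑ i, ∑ j, X i j ^ 2 := by
    simp [Matrix.trace, Matrix.mul_apply, sq]
  rw [h]
  refine (Finset.sum_nonneg fun i _ => Finset.sum_nonneg fun j _ => sq_nonneg _).lt_of_ne' ?_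
  intro h0
  refine hX.ne_zero ?_
  ext i j
  have h1 := (Finset.sum_eq_zero_iff_of_nonneg fun i _ =>
    Finset.sum_nonneg fun j _ => sq_nonneg (X i j)).1 h0 i (Finset.mem_univ i)
  have h2 := (Finset.sum_eq_zero_iff_of_nonneg fun j _ => sq_nonneg (X i j)).1 h1 j
    (Finset.mem_univ j)
  exact pow_eq_zero_iff two_ne_zero |>.1 h2

/-- The Gram matrix `YᵀY` in terms of `P = XᵀX` and `L = XᵀY`. -/
lemma transpose_mul_self_eq_of_mul_gram {X Y Q : Matrix ι ι ℝ} (hQ : Xᵀ * X * Q = 1) :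
    Yᵀ * Y = (Xᵀ * Y)ᵀ * Q * (Xᵀ * Y) := by
  have h₁ : X * Q * Xᵀ = 1 := by
    rw [Matrix.mul_assoc] at hQ
    exact mul_eq_one_comm.1 hQ
  calc Yᵀ * Y = Yᵀ * (X * Q * Xᵀ) * Y := by
        rw [h₁, Matrix.mul_one]
    _ = _ := by simp only [Matrix.transpose_mul, Matrix.transpose_transpose, Matrix.mul_assoc]

lemma adjugate_eq_inv_of_det_eq_one {X : Matrix ι ι ℝ} (hX : X.det = 1) : X.adjugate = X⁻¹ := by
  rw [Matrix.inv_def, hX]; simp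

lemma contDiffAt_geodesicField [Nonempty ι] {x : Matrix ι ι ℝ × Matrix ι ι ℝ}
    (hx : x.1.det = 1) : ContDiffAt ℝ 1 (geodesicField (ι := ι)) x := by
  have h₁ : ContDiff ℝ 1 fun x : Matrix ι ι ℝ × Matrix ι ι ℝ => x.1.adjugate :=
    contDiff_fst.matrix_adjugate'
  have h₂ : ContDiff ℝ 1 fun x : Matrix ι ι ℝ × Matrix ι ι ℝ => x.2 := contDiff_snd
  have hpos : 0 < Matrix.trace (x.1.adjugate * (x.1.adjugate)ᵀ) := by
    refine trace_mul_transpose_self_pos ?_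
    rw [Matrix.isUnit_iff_isUnit_det, Matrix.det_adjugate, hx, one_pow]
    exact isUnit_one
  exact h₂.contDiffAt.prodMk (ContDiffAt.smul
    ((((h₂.matrix_mul' h₁).matrix_mul' h₂).matrix_mul' h₁).matrix_trace'.contDiffAt.div
      (h₁.matrix_mul' h₁.matrix_transpose').matrix_trace'.contDiffAt hpos.ne')
    h₁.matrix_transpose'.contDiffAt)

namespace IsGeodesic

variable {A B : ℝ → Matrix ι ι ℝ}

lemma hasDerivAt (hA : IsGeodesic A) (t : ℝ) : HasDerivAt A (deriv A t) t :=
  (hA.1 t).hasDerivAt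

lemma hasDerivAt_deriv (hA : IsGeodesic A) (t : ℝ) :
    HasDerivAt (deriv A) (geodesicMultiplier (A t) (deriv A t) • ((A t)⁻¹)ᵀ) t :=
  (hA.2.1 t).hasDerivAt.congr_deriv (hA.2.2.2 t)

lemma isUnit_det (hA : IsGeodesic A) (t : ℝ) : IsUnit (A t).det := by
  rw [hA.2.2.1 t]; exact isUnit_one

lemma hasDerivAt_pair (hA : IsGeodesic A) (t : ℝ) :
    HasDerivAt (fun t => (A t, deriv A t)) (geodesicField (A t, deriv A t)) t := by
  refine (hA.hasDerivAt t).prodMk ?_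
  simp only [adjugate_eq_inv_of_det_eq_one (hA.2.2.1 t)]
  exact hA.hasDerivAt_deriv t

/-- Geodesics are determined by their initial data. -/
lemma eq_of_initial_eq [Nonempty ι] (hA : IsGeodesic A) (hB : IsGeodesic B) (h₀ : A 0 = B 0)
    (h₁ : deriv A 0 = deriv B 0) : A = B := by
  have hcA : Continuous fun t => (A t, deriv A t) :=
    continuous_iff_continuousAt.2 fun t => (hA.hasDerivAt_pair t).continuousAt
  have hcB : Continuous fun t => (B t, deriv B t) :=
    continuous_iff_continuousAt.2 fun t => (hB.hasDerivAt_pair t).continuousAt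
  have hclopen : IsClopen {t | (A t, deriv A t) = (B t, deriv B t)} := by
    refine ⟨isClosed_eq hcA hcB, isOpen_iff_mem_nhds.2 fun t ht => ?_⟩
    obtain ⟨K, s, hs, hK⟩ :=
      (contDiffAt_geodesicField (x := (A t, deriv A t)) (hA.2.2.1 t)).exists_lipschitzOnWith
    have ht' : (A t, deriv A t) = (B t, deriv B t) := ht
    refine ODE_solution_unique_of_eventually (v := fun _ => geodesicField) (s := fun _ => s)
      (Eventually.of_forall fun _ => hK) ?_ ?_ ht'
    · filter_upwards [hcA.continuousAt.preimage_mem_nhds hs] with r hr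
      exact ⟨hA.hasDerivAt_pair r, hr⟩
    · filter_upwards [hcB.continuousAt.preimage_mem_nhds (show s ∈ nhds (B t, deriv B t) from
        ht' ▸ hs)] with r hr
      exact ⟨hB.hasDerivAt_pair r, hr⟩
  have huniv := hclopen.eq_univ ⟨0, Prod.ext h₀ h₁⟩
  funext t
  have : t ∈ {t | (A t, deriv A t) = (B t, deriv B t)} := huniv ▸ Set.mem_univ t
  exact congrArg Prod.fst this

lemma const_mul_mul (hA : IsGeodesic A) {U V : Matrix ι ι ℝ} (hU : Uᵀ * U = 1)
    (hV : Vᵀ * V = 1) (hUV : U.det * V.det = 1) : IsGeodesic fun t => U * A t * V := by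
  have hU' : U⁻¹ = Uᵀ := Matrix.inv_eq_left_inv hU
  have hV' : V⁻¹ = Vᵀ := Matrix.inv_eq_left_inv hV
  have hVV : V * Vᵀ = 1 := mul_eq_one_comm.1 hV
  have hd : deriv (fun t => U * A t * V) = fun t => U * deriv A t * V :=
    funext fun t => ((hA.hasDerivAt t).matrix_const_mul_mul U V).deriv
  have hd2 := fun t => (hA.hasDerivAt_deriv t).matrix_const_mul_mul U V
  refine ⟨fun t => ((hA.hasDerivAt t).matrix_const_mul_mul U V).differentiableAt,
    fun t => ?_, fun t => ?_, fun t => ?_⟩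
  · rw [hd]
    exact (hd2 t).differentiableAt
  · rw [Matrix.det_mul, Matrix.det_mul, hA.2.2.1 t, mul_one, hUV]
  · rw [hd]
    refine (hd2 t).deriv.trans ?_
    have hinv : (U * A t * V)⁻¹ = Vᵀ * (A t)⁻¹ * Uᵀ := by
      rw [Matrix.mul_inv_rev, Matrix.mul_inv_rev, hU', hV', Matrix.mul_assoc]
    have hmul : U * deriv A t * V * (Vᵀ * (A t)⁻¹ * Uᵀ) = U * (deriv A t * (A t)⁻¹) * Uᵀ := by
      calc _ = U * deriv A t * (V * Vᵀ) * (A t)⁻¹ * Uᵀ := by simp only [Matrix.mul_assoc]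
        _ = _ := by rw [hVV]; simp only [Matrix.mul_assoc, Matrix.mul_one]
    have htr₁ : Matrix.trace (U * deriv A t * V * (Vᵀ * (A t)⁻¹ * Uᵀ) * (U * deriv A t * V) *
        (Vᵀ * (A t)⁻¹ * Uᵀ)) = Matrix.trace (deriv A t * (A t)⁻¹ * deriv A t * (A t)⁻¹) := by
      rw [Matrix.mul_assoc (_ * _) (U * deriv A t * V), hmul]
      calc _ = Matrix.trace (U * (deriv A t * (A t)⁻¹) * (Uᵀ * U) * (deriv A t * (A t)⁻¹) * Uᵀ) := by
            simp only [Matrix.mul_assoc]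
        _ = Matrix.trace (Uᵀ * U * (deriv A t * (A t)⁻¹ * (deriv A t * (A t)⁻¹))) := by
            rw [hU, Matrix.trace_mul_comm, Matrix.mul_one, Matrix.mul_assoc, ← Matrix.mul_assoc, hU]
        _ = _ := by rw [hU, Matrix.one_mul]; simp only [Matrix.mul_assoc]
    have htr₂ : Matrix.trace (Vᵀ * (A t)⁻¹ * Uᵀ * (Vᵀ * (A t)⁻¹ * Uᵀ)ᵀ) =
        Matrix.trace ((A t)⁻¹ * ((A t)⁻¹)ᵀ) := by
      simp only [Matrix.transpose_mul, Matrix.transpose_transpose]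
      calc _ = Matrix.trace (Vᵀ * ((A t)⁻¹ * (Uᵀ * U) * ((A t)⁻¹)ᵀ * V)) := by
            simp only [Matrix.mul_assoc]
        _ = Matrix.trace ((A t)⁻¹ * ((A t)⁻¹)ᵀ * (V * Vᵀ)) := by
            rw [Matrix.trace_mul_comm, hU, Matrix.mul_one]
            simp only [Matrix.mul_assoc]
        _ = _ := by rw [hVV, Matrix.mul_one]
    rw [hinv, htr₁, htr₂, geodesicMultiplier]
    simp only [Matrix.transpose_mul, Matrix.transpose_transpose, Matrix.mul_smul, Matrix.smul_mul,
      Matrix.mul_assoc]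

/-- An orthogonal matrix commuting with the initial data commutes with `AᵀA` for all time. -/
lemma commute_gram [Nonempty ι] (hA : IsGeodesic A) {V : Matrix ι ι ℝ} (hV : Vᵀ * V = 1)
    (h₀ : V * ((A 0)ᵀ * A 0) = (A 0)ᵀ * A 0 * V)
    (h₁ : V * ((A 0)ᵀ * deriv A 0) = (A 0)ᵀ * deriv A 0 * V) (t : ℝ) :
    V * ((A t)ᵀ * A t) = (A t)ᵀ * A t * V := by
  have hVV : V * Vᵀ = 1 := mul_eq_one_comm.1 hV
  have hAi : A 0 * (A 0)⁻¹ = 1 := Matrix.mul_nonsing_inv _ (hA.isUnit_det 0)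
  have hAi' : (A 0)⁻¹ * A 0 = 1 := Matrix.nonsing_inv_mul _ (hA.isUnit_det 0)
  have hAt : ((A 0)⁻¹)ᵀ * (A 0)ᵀ = 1 := by rw [← Matrix.transpose_mul, hAi, Matrix.transpose_one]
  have h₁' : (A 0)ᵀ * A 0 * Vᵀ = Vᵀ * ((A 0)ᵀ * A 0) := by
    have := congrArg Matrix.transpose h₀
    simpa [Matrix.mul_assoc] using this
  set U := A 0 * Vᵀ * (A 0)⁻¹ with hUdef
  have hU : Uᵀ * U = 1 := by
    calc Uᵀ * U = ((A 0)⁻¹)ᵀ * (V * ((A 0)ᵀ * A 0 * Vᵀ)) * (A 0)⁻¹ := by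
          simp only [hUdef, Matrix.transpose_mul, Matrix.transpose_transpose, Matrix.mul_assoc]
      _ = ((A 0)⁻¹)ᵀ * ((V * Vᵀ) * ((A 0)ᵀ * A 0)) * (A 0)⁻¹ := by
          rw [h₁']; simp only [Matrix.mul_assoc]
      _ = (((A 0)⁻¹)ᵀ * (A 0)ᵀ) * (A 0 * (A 0)⁻¹) := by
          rw [hVV, Matrix.one_mul]; simp only [Matrix.mul_assoc]
      _ = 1 := by rw [hAt, hAi, Matrix.one_mul]
  have hUA : U * A 0 = A 0 * Vᵀ := by
    rw [hUdef, Matrix.mul_assoc, hAi', Matrix.mul_one]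
  have hdet : U.det * V.det = 1 := by
    have hAd : (A 0).det * ((A 0)⁻¹).det = 1 := by rw [← Matrix.det_mul, hAi, Matrix.det_one]
    have hVd : (Vᵀ).det * V.det = 1 := by rw [← Matrix.det_mul, hV, Matrix.det_one]
    rw [hUdef, Matrix.det_mul, Matrix.det_mul]
    linear_combination hVd + (Vᵀ).det * V.det * hAd
  have hB := hA.const_mul_mul hU hV hdet
  have hvel : U * deriv A 0 * V = deriv A 0 := by
    have hcancel : ∀ X Y : Matrix ι ι ℝ, (A 0)ᵀ * X = (A 0)ᵀ * Y → X = Y := by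
      intro X Y hXY
      rw [← Matrix.one_mul X, ← hAt, Matrix.mul_assoc, hXY, ← Matrix.mul_assoc, hAt, Matrix.one_mul]
    refine hcancel _ _ ?_
    have hAUt : (A 0)ᵀ * U = Vᵀ * (A 0)ᵀ := by
      calc (A 0)ᵀ * U = (A 0)ᵀ * A 0 * Vᵀ * (A 0)⁻¹ := by
            simp only [hUdef, Matrix.mul_assoc]
        _ = Vᵀ * (A 0)ᵀ * (A 0 * (A 0)⁻¹) := by rw [h₁']; simp only [Matrix.mul_assoc]
        _ = _ := by rw [hAi, Matrix.mul_one]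
    calc (A 0)ᵀ * (U * deriv A 0 * V) = Vᵀ * ((A 0)ᵀ * deriv A 0 * V) := by
          rw [← Matrix.mul_assoc, ← Matrix.mul_assoc, hAUt]; simp only [Matrix.mul_assoc]
      _ = (A 0)ᵀ * deriv A 0 := by rw [← h₁, ← Matrix.mul_assoc, hV, Matrix.one_mul]
  have heq : A = fun t => U * A t * V := by
    refine hA.eq_of_initial_eq hB ?_ ?_
    · rw [hUA, Matrix.mul_assoc, hV, Matrix.mul_one]
    · exact (((hA.hasDerivAt 0).matrix_const_mul_mul U V).deriv.trans hvel).symm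
  have ht : A t = U * A t * V := congrFun heq t
  have hP : (A t)ᵀ * A t = Vᵀ * ((A t)ᵀ * A t) * V := by
    calc (A t)ᵀ * A t = (U * A t * V)ᵀ * (U * A t * V) := by rw [← ht]
      _ = Vᵀ * ((A t)ᵀ * (Uᵀ * U) * A t) * V := by
          simp only [Matrix.transpose_mul, Matrix.mul_assoc]
      _ = _ := by rw [hU, Matrix.mul_one]
  calc V * ((A t)ᵀ * A t) = V * (Vᵀ * ((A t)ᵀ * A t) * V) := by rw [← hP]
    _ = (V * Vᵀ) * ((A t)ᵀ * A t) * V := by simp only [Matrix.mul_assoc]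
    _ = _ := by rw [hVV, Matrix.one_mul]

/-- Conservation of the right angular momentum `Aᵀ A' - A'ᵀ A`. -/
lemma momentum_eq (hA : IsGeodesic A) (t : ℝ) :
    (A t)ᵀ * deriv A t - (deriv A t)ᵀ * A t = (A 0)ᵀ * deriv A 0 - (deriv A 0)ᵀ * A 0 := by
  have hd : ∀ t, HasDerivAt (fun t => (A t)ᵀ * deriv A t - (deriv A t)ᵀ * A t) 0 t := by
    intro t
    have hi : (A t)⁻¹ * A t = 1 := Matrix.nonsing_inv_mul _ (hA.isUnit_det t)
    have hi' : (A t)ᵀ * ((A t)⁻¹)ᵀ = 1 := by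
      rw [← Matrix.transpose_mul, hi, Matrix.transpose_one]
    refine (((hA.hasDerivAt t).matrix_transpose'.matrix_mul' (hA.hasDerivAt_deriv t)).sub
      ((hA.hasDerivAt_deriv t).matrix_transpose'.matrix_mul' (hA.hasDerivAt t))).congr_deriv
        (sub_eq_zero_of_eq ?_)
    rw [transpose_smul, transpose_transpose, Matrix.smul_mul, Matrix.mul_smul, hi, hi', add_comm]
  exact is_const_of_deriv_eq_zero (fun t => (hd t).differentiableAt) (fun t => (hd t).deriv) t 0

lemma hasDerivAt_gram (hA : IsGeodesic A) (t : ℝ) :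
    HasDerivAt (fun t => (A t)ᵀ * A t) ((deriv A t)ᵀ * A t + (A t)ᵀ * deriv A t) t :=
  (hA.hasDerivAt t).matrix_transpose'.matrix_mul' (hA.hasDerivAt t)

lemma hasDerivAt_deriv_gram (hA : IsGeodesic A) (t : ℝ) :
    HasDerivAt (fun t => (deriv A t)ᵀ * A t + (A t)ᵀ * deriv A t)
      ((2 * geodesicMultiplier (A t) (deriv A t)) • 1 +
        (2 : ℝ) • ((deriv A t)ᵀ * deriv A t)) t := by
  have hi : (A t)⁻¹ * A t = 1 := Matrix.nonsing_inv_mul _ (hA.isUnit_det t)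
  have hi' : (A t)ᵀ * ((A t)⁻¹)ᵀ = 1 := by
    rw [← Matrix.transpose_mul, hi, Matrix.transpose_one]
  set c := geodesicMultiplier (A t) (deriv A t)
  have h : (c • ((A t)⁻¹)ᵀ)ᵀ * A t + (deriv A t)ᵀ * deriv A t +
      ((deriv A t)ᵀ * deriv A t + (A t)ᵀ * (c • ((A t)⁻¹)ᵀ)) =
        (2 * c) • 1 + (2 : ℝ) • ((deriv A t)ᵀ * deriv A t) := by
    rw [transpose_smul, transpose_transpose, Matrix.smul_mul, Matrix.mul_smul, hi, hi', two_mul,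
      add_smul, two_smul]
    abel
  exact (((hA.hasDerivAt_deriv t).matrix_transpose'.matrix_mul' (hA.hasDerivAt t)).add
    ((hA.hasDerivAt t).matrix_transpose'.matrix_mul' (hA.hasDerivAt_deriv t))).congr_deriv h

end IsGeodesic

end Geodesic

section Reduction

lemma exists_reducedMotion_of_hasDerivAt {D E z : ℝ} (hD : 0 < D) (hE : 0 < E)
    {p p' p'' q q' q'' : ℝ → ℝ} (hp : ∀ t, 0 < p t) (hq : ∀ t, 0 < q t)
    (hp₁ : ∀ t, HasDerivAt p (p' t) t) (hp₂ : ∀ t, HasDerivAt p' (p'' t) t)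
    (hq₁ : ∀ t, HasDerivAt q (q' t) t) (hq₂ : ∀ t, HasDerivAt q' (q'' t) t)
    (hvol : ∀ t, D * Real.log (p t) + E * Real.log (q t) = 0)
    (hode : ∀ t, p'' t - (p' t ^ 2 + z ^ 2) / (2 * p t) = q'' t - q' t ^ 2 / (2 * q t)) :
    ∃ b b' b'' : ℝ → ℝ, (∀ t, HasDerivAt b (b' t) t) ∧ (∀ t, HasDerivAt b' (b'' t) t) ∧
      (∀ t, p t = Real.exp (-b t / D)) ∧ (∀ t, q t = Real.exp (b t / E)) ∧
      (∀ t, b' t = E * (q' t / q t)) ∧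
      IsReducedMotion D E z b (fun t => b' t * √(reducedMetric D E (b t))) := by
  have hlogq₁ : ∀ t, HasDerivAt (fun t => E * Real.log (q t)) (E * (q' t / q t)) t :=
    fun t => ((hq₁ t).log (hq t).ne').const_mul E
  have hlogp₁ : ∀ t, HasDerivAt (fun t => D * Real.log (p t)) (D * (p' t / p t)) t :=
    fun t => ((hp₁ t).log (hp t).ne').const_mul D
  have hlogq₂ : ∀ t, HasDerivAt (fun t => E * (q' t / q t))
      (E * ((q'' t * q t - q' t * q' t) / q t ^ 2)) t :=
    fun t => ((hq₂ t).div (hq₁ t) (hq t).ne').const_mul E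
  have hlogp₂ : ∀ t, HasDerivAt (fun t => D * (p' t / p t))
      (D * ((p'' t * p t - p' t * p' t) / p t ^ 2)) t :=
    fun t => ((hp₂ t).div (hp₁ t) (hp t).ne').const_mul D
  have hvol₁ : ∀ t, D * (p' t / p t) + E * (q' t / q t) = 0 := fun t =>
    ((hlogp₁ t).add (hlogq₁ t)).unique
      ((hasDerivAt_const t (0 : ℝ)).congr_of_eventuallyEq (Eventually.of_forall hvol))
  have hvol₂ : ∀ t, D * ((p'' t * p t - p' t * p' t) / p t ^ 2) +
      E * ((q'' t * q t - q' t * q' t) / q t ^ 2) = 0 := fun t =>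
    ((hlogp₂ t).add (hlogq₂ t)).unique
      ((hasDerivAt_const t (0 : ℝ)).congr_of_eventuallyEq (Eventually.of_forall hvol₁))
  have hpb : ∀ t, Real.exp (-(E * Real.log (q t)) / D) = p t := fun t => by
    rw [show -(E * Real.log (q t)) / D = Real.log (p t) by
      rw [div_eq_iff hD.ne']; linarith [hvol t], Real.exp_log (hp t)]
  have hpb' : ∀ t, Real.exp (E * Real.log (q t) / D) = (p t)⁻¹ := fun t => by
    rw [← hpb t, ← Real.exp_neg, neg_div, neg_neg]
  have hqb : ∀ t, Real.exp (E * Real.log (q t) / E) = q t := fun t => by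
    rw [mul_div_cancel_left₀ _ hE.ne', Real.exp_log (hq t)]
  refine ⟨_, _, _, hlogq₁, hlogq₂, fun t => (hpb t).symm, fun t => (hqb t).symm, fun _ => rfl,
    isReducedMotion_of_hasDerivAt hD hE hlogq₁ hlogq₂ fun t => ?_⟩
  rw [reducedMetric, hpb, hpb', hqb]
  have h₀ := hode t
  have h₁ := hvol₁ t
  have h₂ := hvol₂ t
  have hpt := hp t
  have hqt := hq t
  generalize p t = p at *
  generalize q t = q at *
  generalize p' t = p₁ at *
  generalize q' t = q₁ at *
  generalize p'' t = p₂ at *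
  generalize q'' t = q₂ at *
  have e₁ : E * (q₁ / q) = -(D * (p₁ / p)) := by linarith
  have e₂ : E * ((q₂ * q - q₁ * q₁) / q ^ 2) = -(D * ((p₂ * p - p₁ * p₁) / p ^ 2)) := by linarith
  have s₁ : E * ((q₂ * q - q₁ * q₁) / q ^ 2) * (q / E) = q₂ - q₁ ^ 2 / q := by field_simp
  have s₂ : E * ((q₂ * q - q₁ * q₁) / q ^ 2) * (p / D) = -(p₂ - p₁ ^ 2 / p) := by
    rw [e₂]; field_simp
  have s₃ : (E * (q₁ / q)) ^ 2 * (q / E ^ 2) = q₁ ^ 2 / q := by field_simp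
  have s₄ : (E * (q₁ / q)) ^ 2 * (p / D ^ 2) = p₁ ^ 2 / p := by rw [e₁]; field_simp
  have s₅ : (p₁ ^ 2 + z ^ 2) / (2 * p) = p₁ ^ 2 / p / 2 + z ^ 2 / 2 * p⁻¹ := by field_simp
  have s₆ : q₁ ^ 2 / (2 * q) = q₁ ^ 2 / q / 2 := by field_simp
  rw [s₅, s₆] at h₀
  linear_combination s₁ + s₂ + s₃ / 2 - s₄ / 2 - h₀

variable {ι κ : Type*} [Fintype ι] [DecidableEq ι] [Fintype κ] [DecidableEq κ]

lemma det_fromBlocks_smul_one (p q : ℝ) :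
    (fromBlocks (p • (1 : Matrix κ κ ℝ)) 0 0 (q • (1 : Matrix ι ι ℝ))).det =
      p ^ Fintype.card κ * q ^ Fintype.card ι := by
  rw [det_fromBlocks_zero₂₁, det_smul, det_smul, det_one, det_one, mul_one, mul_one]

lemma fromBlocks_smul_one_mul_inv {p q : ℝ} (hp : p ≠ 0) (hq : q ≠ 0) :
    fromBlocks (p • (1 : Matrix κ κ ℝ)) 0 0 (q • (1 : Matrix ι ι ℝ)) *
      fromBlocks (p⁻¹ • 1) 0 0 (q⁻¹ • 1) = 1 := by
  simp [fromBlocks_multiply, smul_smul, hp, hq]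

lemma transpose_mul_fromBlocks_mul_self (p q p' q' z : ℝ) :
    (fromBlocks ((p' / 2) • 1 + (z / 2) • blockZ2 κ) 0 0 ((q' / 2) • (1 : Matrix ι ι ℝ)))ᵀ *
      fromBlocks (p⁻¹ • 1) 0 0 (q⁻¹ • 1) *
      fromBlocks ((p' / 2) • 1 + (z / 2) • blockZ2 κ) 0 0 ((q' / 2) • (1 : Matrix ι ι ℝ)) =
    fromBlocks (((p' ^ 2 + z ^ 2) / (4 * p)) • 1) 0 0 ((q' ^ 2 / (4 * q)) • 1) := by
  simp only [fromBlocks_transpose, fromBlocks_multiply, transpose_add, transpose_smul,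
    transpose_one, transpose_zero, transpose_blockZ2, Matrix.zero_mul, Matrix.mul_zero, add_zero,
    zero_add, Matrix.add_mul, Matrix.mul_add, Matrix.smul_mul, Matrix.mul_smul, Matrix.one_mul,
    Matrix.mul_one, Matrix.neg_mul, blockZ2_mul_self, neg_neg, smul_neg, smul_smul]
  refine fromBlocks_inj.2 ⟨?_, by simp, by simp, ?_⟩
  · have h : (p' ^ 2 + z ^ 2) / (4 * p) = p' / 2 * (p⁻¹ * (p' / 2)) + z / 2 * (p⁻¹ * (z / 2)) := by
      rw [div_eq_mul_inv, mul_inv]; ring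
    rw [h, add_smul]
    module
  · congr 1
    ring

namespace IsGeodesic

variable {A : ℝ → Matrix ((Fin 2 × κ) ⊕ ι) ((Fin 2 × κ) ⊕ ι) ℝ} {p₀ q₀ p₁ q₁ z : ℝ}

lemma transpose_mul_deriv_eq {X Y : Matrix ((Fin 2 × κ) ⊕ ι) ((Fin 2 × κ) ⊕ ι) ℝ}
    (h₂ : Xᵀ * Y - Yᵀ * X = fromBlocks (z • blockZ2 κ) 0 0 0)
    (h₃ : Yᵀ * X + Xᵀ * Y = fromBlocks (p₁ • 1) 0 0 (q₁ • 1)) :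
    Xᵀ * Y =
      fromBlocks ((p₁ / 2) • 1 + (z / 2) • blockZ2 κ) 0 0 ((q₁ / 2) • (1 : Matrix ι ι ℝ)) := by
  have h : Xᵀ * Y = (1 / 2 : ℝ) • ((Xᵀ * Y - Yᵀ * X) + (Yᵀ * X + Xᵀ * Y)) := by module
  rw [h, h₂, h₃, fromBlocks_add, fromBlocks_smul]
  refine fromBlocks_inj.2 ⟨by module, by simp, by simp, by module⟩

lemma exists_gram_eq [Nonempty ι] (hA : IsGeodesic A)
    (h₁ : (A 0)ᵀ * A 0 = fromBlocks (p₀ • 1) 0 0 (q₀ • 1))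
    (h₂ : (A 0)ᵀ * deriv A 0 - (deriv A 0)ᵀ * A 0 = fromBlocks (z • blockZ2 κ) 0 0 0)
    (h₃ : (deriv A 0)ᵀ * A 0 + (A 0)ᵀ * deriv A 0 = fromBlocks (p₁ • 1) 0 0 (q₁ • 1)) (t : ℝ) :
    ∃ p q : ℝ, (A t)ᵀ * A t = fromBlocks (p • 1) 0 0 (q • 1) := by
  refine exists_eq_fromBlocks_smul_one _ (by simp) fun V₁ V₂ hV₁ hVK hV₂ => ?_
  refine hA.commute_gram ?_ ?_ ?_ t
  · simp [fromBlocks_transpose, fromBlocks_multiply, hV₁, hV₂]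
  · simp [h₁, fromBlocks_multiply]
  · rw [transpose_mul_deriv_eq h₂ h₃]
    simp [fromBlocks_multiply, Matrix.mul_add, Matrix.add_mul, hVK]

lemma exists_reducedMotion [Nonempty ι] [Nonempty κ] (hA : IsGeodesic A)
    (h₁ : (A 0)ᵀ * A 0 = fromBlocks (p₀ • 1) 0 0 (q₀ • 1))
    (h₂ : (A 0)ᵀ * deriv A 0 - (deriv A 0)ᵀ * A 0 = fromBlocks (z • blockZ2 κ) 0 0 0)
    (h₃ : (deriv A 0)ᵀ * A 0 + (A 0)ᵀ * deriv A 0 = fromBlocks (p₁ • 1) 0 0 (q₁ • 1)) :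
    ∃ b b' b'' : ℝ → ℝ, (∀ t, HasDerivAt b (b' t) t) ∧ (∀ t, HasDerivAt b' (b'' t) t) ∧
      (∀ t, (A t)ᵀ * A t = fromBlocks (Real.exp (-b t / (2 * Fintype.card κ)) • 1) 0 0
        (Real.exp (b t / Fintype.card ι) • 1)) ∧
      b' 0 = Fintype.card ι * (q₁ / q₀) ∧
      IsReducedMotion (2 * Fintype.card κ) (Fintype.card ι) z b
        (fun t => b' t * √(reducedMetric (2 * Fintype.card κ) (Fintype.card ι) (b t))) := by
  have k : κ := Classical.arbitrary κ
  have j : ι := Classical.arbitrary ι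
  have hD : (0 : ℝ) < 2 * Fintype.card κ := by
    have : 0 < Fintype.card κ := Fintype.card_pos
    positivity
  have hE : (0 : ℝ) < Fintype.card ι := by
    have : 0 < Fintype.card ι := Fintype.card_pos
    positivity
  set P := fun t => (A t)ᵀ * A t with hPdef
  set P' := fun t => (deriv A t)ᵀ * A t + (A t)ᵀ * deriv A t with hP'def
  set c := fun t => geodesicMultiplier (A t) (deriv A t)
  set P'' := fun t => (2 * c t) • (1 : Matrix ((Fin 2 × κ) ⊕ ι) ((Fin 2 × κ) ⊕ ι) ℝ) +
    (2 : ℝ) • ((deriv A t)ᵀ * deriv A t) with hP''def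
  have hP₁ : ∀ t, HasDerivAt P (P' t) t := hA.hasDerivAt_gram
  have hP₂ : ∀ t, HasDerivAt P' (P'' t) t := hA.hasDerivAt_deriv_gram
  set x : (Fin 2 × κ) ⊕ ι := Sum.inl (0, k)
  set y : (Fin 2 × κ) ⊕ ι := Sum.inr j
  have hp₁ := fun t => hasDerivAt_matrix_iff.1 (hP₁ t) x x
  have hp₂ := fun t => hasDerivAt_matrix_iff.1 (hP₂ t) x x
  have hq₁ := fun t => hasDerivAt_matrix_iff.1 (hP₁ t) y y
  have hq₂ := fun t => hasDerivAt_matrix_iff.1 (hP₂ t) y y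
  have hP : ∀ t, P t = fromBlocks (P t x x • 1) 0 0 (P t y y • 1) := by
    intro t
    obtain ⟨p, q, h⟩ := hA.exists_gram_eq h₁ h₂ h₃ t
    have h : P t = fromBlocks (p • 1) 0 0 (q • 1) := h
    have hx : P t x x = p := by rw [h]; simp [x]
    have hy : P t y y = q := by rw [h]; simp [y]
    rw [hx, hy, h]
  have hP' : ∀ t, P' t = fromBlocks (P' t x x • 1) 0 0 (P' t y y • 1) := by
    intro t
    have hd : HasDerivAt (fun t => (fromBlocks (P t x x • 1) 0 0 (P t y y • 1) :
        Matrix ((Fin 2 × κ) ⊕ ι) ((Fin 2 × κ) ⊕ ι) ℝ))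
        (fromBlocks (P' t x x • 1) 0 0 (P' t y y • 1)) t := by
      refine hasDerivAt_matrix_iff.2 ?_
      rintro (a | a) (b | b)
      · simpa using (hp₁ t).mul_const _
      · simpa using hasDerivAt_const t (0 : ℝ)
      · simpa using hasDerivAt_const t (0 : ℝ)
      · simpa using (hq₁ t).mul_const _
    exact (hP₁ t).unique (hd.congr_of_eventuallyEq (Eventually.of_forall hP))
  have hdet : ∀ t, P t x x ^ Fintype.card (Fin 2 × κ) * P t y y ^ Fintype.card ι = 1 := by
    intro t
    rw [← det_fromBlocks_smul_one, ← hP t, hPdef]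
    simp [hA.2.2.1 t]
  have hnonneg : ∀ t a, 0 ≤ P t a a := by
    intro t a
    simp only [hPdef, Matrix.mul_apply, Matrix.transpose_apply]
    exact Finset.sum_nonneg fun _ _ => mul_self_nonneg _
  have hp : ∀ t, 0 < P t x x := fun t => (hnonneg t x).lt_of_ne' fun h => by
    have := hdet t
    rw [h, zero_pow Fintype.card_ne_zero, zero_mul] at this
    exact zero_ne_one this
  have hq : ∀ t, 0 < P t y y := fun t => (hnonneg t y).lt_of_ne' fun h => by
    have := hdet t
    rw [h, zero_pow Fintype.card_ne_zero, mul_zero] at this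
    exact zero_ne_one this
  have hvol : ∀ t, (2 * Fintype.card κ : ℝ) * Real.log (P t x x) +
      Fintype.card ι * Real.log (P t y y) = 0 := by
    intro t
    have h := congrArg Real.log (hdet t)
    rw [Real.log_mul (pow_pos (hp t) _).ne' (pow_pos (hq t) _).ne', Real.log_pow, Real.log_pow,
      Real.log_one] at h
    simpa using h
  have hP'' : ∀ t, P'' t = (2 * c t) • 1 + (2 : ℝ) •
      fromBlocks (((P' t x x ^ 2 + z ^ 2) / (4 * P t x x)) • 1) 0 0
        ((P' t y y ^ 2 / (4 * P t y y)) • 1) := by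
    intro t
    have hL := transpose_mul_deriv_eq ((hA.momentum_eq t).trans h₂) (hP' t)
    have hQ : (A t)ᵀ * A t * fromBlocks ((P t x x)⁻¹ • 1) 0 0 ((P t y y)⁻¹ • 1) = 1 := by
      rw [← fromBlocks_smul_one_mul_inv (hp t).ne' (hq t).ne', ← hP t]
    rw [hP''def]
    simp only
    rw [transpose_mul_self_eq_of_mul_gram hQ, hL, transpose_mul_fromBlocks_mul_self]
  have hode : ∀ t, P'' t x x - (P' t x x ^ 2 + z ^ 2) / (2 * P t x x) =
      P'' t y y - P' t y y ^ 2 / (2 * P t y y) := by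
    intro t
    have hx : P'' t x x = 2 * c t + 2 * ((P' t x x ^ 2 + z ^ 2) / (4 * P t x x)) := by
      rw [hP'' t]; simp [x]
    have hy : P'' t y y = 2 * c t + 2 * (P' t y y ^ 2 / (4 * P t y y)) := by
      rw [hP'' t]; simp [y]
    rw [hx, hy]
    have := (hp t).ne'
    have := (hq t).ne'
    field_simp
    ring
  obtain ⟨b, b', b'', hb₁, hb₂, hpb, hqb, hb', hred⟩ :=
    exists_reducedMotion_of_hasDerivAt hD hE hp hq hp₁ hp₂ hq₁ hq₂ hvol hode
  refine ⟨b, b', b'', hb₁, hb₂, fun t => ?_, ?_, hred⟩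
  · rw [← hpb, ← hqb]
    exact hP t
  · have hq₀ : P 0 y y = q₀ := by
      have := congrFun (congrFun h₁ y) y
      simpa [y] using this
    have hq₁' : P' 0 y y = q₁ :=
      (congrFun (congrFun h₃ y) y).trans (by simp [y])
    rw [hb', hq₀, hq₁']

end IsGeodesic

end Reduction

/-- generalized swirling and shear flows. -/
theorem statement_19 {n m₀ : ℕ} (hm₀ : 1 ≤ m₀) (hn : 2 * m₀ < n)
    (β₀ : ℝ) (hβ₀ : 0 < β₀) (z₀ v : ℝ)
    (A : ℝ → Matrix ((Fin 2 × Fin m₀) ⊕ Fin (n - 2 * m₀))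
      ((Fin 2 × Fin m₀) ⊕ Fin (n - 2 * m₀)) ℝ)
    (hgeo : IsGeodesic A)
    (h₁ : (A 0)ᵀ * A 0 =
      Matrix.fromBlocks
        ((β₀ ^ (-(1 : ℝ) / (2 * m₀))) • (1 : Matrix (Fin 2 × Fin m₀) (Fin 2 × Fin m₀) ℝ))
        0 0
        ((β₀ ^ ((1 : ℝ) / ((n : ℝ) - 2 * m₀))) •
          (1 : Matrix (Fin (n - 2 * m₀)) (Fin (n - 2 * m₀)) ℝ)))
    (h₂ : (A 0)ᵀ * deriv A 0 - (deriv A 0)ᵀ * A 0 =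
      Matrix.fromBlocks (Matrix.blockDiagonal fun _ : Fin m₀ => z₀ • Z2) 0 0 0)
    (h₃ : (A 0)ᵀ * deriv A 0 + (deriv A 0)ᵀ * A 0 =
      Matrix.fromBlocks
        ((v * β₀ ^ (-(1 : ℝ) / (2 * m₀)) / (2 * m₀)) •
          (1 : Matrix (Fin 2 × Fin m₀) (Fin 2 × Fin m₀) ℝ))
        0 0
        ((-v * β₀ ^ ((1 : ℝ) / ((n : ℝ) - 2 * m₀)) / ((n : ℝ) - 2 * m₀)) •
          (1 : Matrix (Fin (n - 2 * m₀)) (Fin (n - 2 * m₀)) ℝ))) :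
    ∃ b : ℝ → ℝ,
      (∀ t, DifferentiableAt ℝ b t) ∧ (∀ t, DifferentiableAt ℝ (deriv b) t) ∧
      (∀ t : ℝ, (A t)ᵀ * A t =
        Matrix.fromBlocks
          (Real.exp (-b t / (2 * m₀)) • (1 : Matrix (Fin 2 × Fin m₀) (Fin 2 × Fin m₀) ℝ))
          0 0
          (Real.exp (b t / ((n : ℝ) - 2 * m₀)) •
            (1 : Matrix (Fin (n - 2 * m₀)) (Fin (n - 2 * m₀)) ℝ))) ∧
      (z₀ ≠ 0 → Tendsto b atTop atBot ∧ Tendsto b atBot atBot) ∧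
      (z₀ = 0 → v ≠ 0 →
        (StrictMono b ∨ StrictAnti b) ∧ Set.range b = Set.univ) := by
  have hE : ((n - 2 * m₀ : ℕ) : ℝ) = (n : ℝ) - 2 * m₀ := by
    rw [Nat.cast_sub hn.le]; push_cast; rfl
  have hEpos : 0 < (n : ℝ) - 2 * m₀ := by
    rw [← hE]; exact_mod_cast Nat.sub_pos_of_lt hn
  have hDpos : (0 : ℝ) < 2 * m₀ := by
    have : 0 < m₀ := hm₀
    positivity
  have : Nonempty (Fin m₀) := ⟨⟨0, hm₀⟩⟩
  have : Nonempty (Fin (n - 2 * m₀)) := ⟨⟨0, Nat.sub_pos_of_lt hn⟩⟩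
  obtain ⟨b, b', b'', hb₁, hb₂, hgram, hb₀, hred⟩ := hgeo.exists_reducedMotion (z := z₀) h₁
    (h₂.trans (by rw [blockZ2, ← blockDiagonal_smul]; rfl)) ((add_comm _ _).trans h₃)
  simp only [Fintype.card_fin, hE] at hgram hb₀ hred
  have hderiv : deriv b = b' := funext fun t => (hb₁ t).deriv
  refine ⟨b, fun t => (hb₁ t).differentiableAt, fun t => ?_, hgram, fun hz =>
    ⟨hred.tendsto_atTop hDpos hEpos hz, hred.tendsto_atBot hDpos hEpos hz⟩, fun hz hv => ?_⟩
  · rw [hderiv]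
    exact (hb₂ t).differentiableAt
  · have hβ := Real.rpow_pos_of_pos hβ₀ ((1 : ℝ) / ((n : ℝ) - 2 * m₀))
    have hb₀' : b' 0 = -v := by rw [hb₀]; field_simp
    have hw : b' 0 * √(reducedMetric (2 * m₀) ((n : ℝ) - 2 * m₀) (b 0)) ≠ 0 := by
      rw [hb₀']
      exact mul_ne_zero (neg_ne_zero.2 hv) (Real.sqrt_pos.2 (reducedMetric_pos hDpos hEpos _)).ne'
    exact ⟨hred.strictMono_or_strictAnti hDpos hEpos hz hw, hred.range_eq_univ hDpos hEpos hz hw⟩
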